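/- Let T be a first-order L-theory with an infinite model, and let κ ≥ |L| + ℵ₀ be a cardinal. If every completion of T is κ-categorical, then T is κ-rich. -/

import Mathlib

open FirstOrder Language

namespace Potentialist

/-- The underlying data of a potentialist system: a collection of worlds, each carrying a
first-order `L`-structure. -/
structure PreSys.{u, v, w, x} (L : FirstOrder.Language.{u, v}) where
  World : Type w
  Dom : World → Type x
  str : ∀ W, L.Structure (Dom W)

attribute [instance] PreSys.str

/-- A potentialist system: a collection of first-order `L`-structures together with a
collection of `L`-embeddings between them, containing all identity embeddings and closed
under composition. -/
structure PotSys.{u, v, w, x} (L : FirstOrder.Language.{u, v})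
    extends PreSys.{u, v, w, x} L where
  Emb : ∀ W W' : World, Set (Dom W ↪[L] Dom W')
  id_mem : ∀ W : World, Embedding.refl L (Dom W) ∈ Emb W W
  comp_mem : ∀ {W W' W'' : World} (f : Dom W ↪[L] Dom W') (g : Dom W' ↪[L] Dom W''),
    f ∈ Emb W W' → g ∈ Emb W' W'' → g.comp f ∈ Emb W W''

/-- Two tuples (in possibly different structures) satisfy the same atomic `L`-formulas. -/
def AtomicEquiv.{u, v, y, z} (L : FirstOrder.Language.{u, v}) {M : Type y} {N : Type z}
    [L.Structure M] [L.Structure N] {n : ℕ} (a : Fin n → M) (b : Fin n → N) : Prop :=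
  ∀ φ : L.Formula (Fin n), BoundedFormula.IsAtomic φ → (φ.Realize a ↔ φ.Realize b)

/-- The type of relations between pairs `(M, ā)` and `(N, b̄)` of equal parameter size. -/
abbrev BisimRel.{u, v, w, x, w', x'} {L : FirstOrder.Language.{u, v}}
    (S : PotSys.{u, v, w, x} L) (T : PotSys.{u, v, w', x'} L) :=
  ∀ (n : ℕ) (M : S.World), (Fin n → S.Dom M) → ∀ N : T.World, (Fin n → T.Dom N) → Prop

/-- `R` is a bisimulation between the potentialist systems `S` and `T`: it is nonempty, and
whenever `R` relates `(M, ā)` to `(N, b̄)`: (B1) `ā` and `b̄` satisfy the same atomic formulas;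
(B2) any extension of either tuple by one element can be matched on the other side;
(B3) any embedding on either side can be matched by an embedding on the other side. -/
def IsBisimulation.{u, v, w, x, w', x'} {L : FirstOrder.Language.{u, v}}
    (S : PotSys.{u, v, w, x} L) (T : PotSys.{u, v, w', x'} L) (R : BisimRel S T) : Prop :=
  (∃ n M a N b, R n M a N b) ∧
  ∀ (n : ℕ) (M : S.World) (a : Fin n → S.Dom M) (N : T.World) (b : Fin n → T.Dom N),
    R n M a N b →
      AtomicEquiv L a b ∧
      (∀ c : S.Dom M, ∃ d : T.Dom N, R (n + 1) M (Fin.snoc a c) N (Fin.snoc b d)) ∧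
      (∀ d : T.Dom N, ∃ c : S.Dom M, R (n + 1) M (Fin.snoc a c) N (Fin.snoc b d)) ∧
      (∀ (M' : S.World) (π : S.Dom M ↪[L] S.Dom M'), π ∈ S.Emb M M' →
        ∃ (N' : T.World) (ρ : T.Dom N ↪[L] T.Dom N'), ρ ∈ T.Emb N N' ∧
          R n M' (fun i => π (a i)) N' (fun i => ρ (b i))) ∧
      (∀ (N' : T.World) (ρ : T.Dom N ↪[L] T.Dom N'), ρ ∈ T.Emb N N' →
        ∃ (M' : S.World) (π : S.Dom M ↪[L] S.Dom M'), π ∈ S.Emb M M' ∧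
          R n M' (fun i => π (a i)) N' (fun i => ρ (b i)))

/-- Two pointed systems are bisimilar if some bisimulation relates them. -/
def Bisimilar.{u, v, w, x, w', x'} {L : FirstOrder.Language.{u, v}}
    (S : PotSys.{u, v, w, x} L) (T : PotSys.{u, v, w', x'} L)
    {n : ℕ} (M : S.World) (a : Fin n → S.Dom M) (N : T.World) (b : Fin n → T.Dom N) : Prop :=
  ∃ R : BisimRel S T, IsBisimulation S T R ∧ R n M a N b

/-- A relation is bitotal if every pair on the left is related to some pair on the right
and vice versa. -/
def Bitotal.{u, v, w, x, w', x'} {L : FirstOrder.Language.{u, v}}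
    (S : PotSys.{u, v, w, x} L) (T : PotSys.{u, v, w', x'} L) (R : BisimRel S T) : Prop :=
  (∀ (n : ℕ) (M : S.World) (a : Fin n → S.Dom M), ∃ N b, R n M a N b) ∧
  (∀ (n : ℕ) (N : T.World) (b : Fin n → T.Dom N), ∃ M a, R n M a N b)

/-- Two potentialist systems are bitotally bisimilar if there is a bitotal bisimulation
between them. -/
def BitotallyBisimilar.{u, v, w, x, w', x'} {L : FirstOrder.Language.{u, v}}
    (S : PotSys.{u, v, w, x} L) (T : PotSys.{u, v, w', x'} L) : Prop :=
  ∃ R : BisimRel S T, IsBisimulation S T R ∧ Bitotal S T R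

/-- An iso-bisimulation between potentialist systems: a nonempty relation between worlds
together with a system of isomorphisms, such that embeddings on either side can be matched
by embeddings on the other side, commuting with the isomorphisms. -/
structure IsoBisim.{u, v, w, x, w', x'} {L : FirstOrder.Language.{u, v}}
    (S : PotSys.{u, v, w, x} L) (T : PotSys.{u, v, w', x'} L) where
  rel : S.World → T.World → Prop
  nonempty : ∃ M N, rel M N
  iso : ∀ {M : S.World} {N : T.World}, rel M N → (S.Dom M ≃[L] T.Dom N)
  forth : ∀ {M : S.World} {N : T.World} (h : rel M N) (M' : S.World)
      (π : S.Dom M ↪[L] S.Dom M'), π ∈ S.Emb M M' →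
      ∃ (N' : T.World) (ρ : T.Dom N ↪[L] T.Dom N') (_ : ρ ∈ T.Emb N N') (h' : rel M' N'),
        ∀ y : S.Dom M, iso h' (π y) = ρ (iso h y)
  back : ∀ {M : S.World} {N : T.World} (h : rel M N) (N' : T.World)
      (ρ : T.Dom N ↪[L] T.Dom N'), ρ ∈ T.Emb N N' →
      ∃ (M' : S.World) (π : S.Dom M ↪[L] S.Dom M') (_ : π ∈ S.Emb M M') (h' : rel M' N'),
        ∀ y : S.Dom M, iso h' (π y) = ρ (iso h y)

/-- An iso-bisimulation is bitotal if every world on either side takes part in the relation. -/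
def IsoBisim.Bitotal.{u, v, w, x, w', x'} {L : FirstOrder.Language.{u, v}}
    {S : PotSys.{u, v, w, x} L} {T : PotSys.{u, v, w', x'} L} (I : IsoBisim S T) : Prop :=
  (∀ M : S.World, ∃ N, I.rel M N) ∧ (∀ N : T.World, ∃ M, I.rel M N)


/-- A structure `M` is `ℵ₀`-saturated if for every finite tuple `ā` of elements of `M`,
every type `p(x)` over the parameters `ā` that is finitely realized in `M` is realized
in `M`. -/
def Aleph0Saturated.{u, v, y} (L : FirstOrder.Language.{u, v}) (M : Type y)
    [L.Structure M] : Prop :=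
  ∀ (n : ℕ) (a : Fin n → M) (p : Set (L.Formula (Fin (n + 1)))),
    (∀ s : Finset (L.Formula (Fin (n + 1))), ↑s ⊆ p →
      ∃ c : M, ∀ φ ∈ s, Formula.Realize φ (Fin.snoc a c)) →
    ∃ c : M, ∀ φ ∈ p, Formula.Realize φ (Fin.snoc a c)

/-- A theory `T` is `κ`-rich, for `κ ≥ |L| + ℵ₀`, if it has an infinite model and all its
models of cardinality `κ` are `ℵ₀`-saturated. -/
def Rich.{u, v} (L : FirstOrder.Language.{u, v}) (T : L.Theory)
    (κ : Cardinal.{max u v}) : Prop :=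
  Language.card L + Cardinal.aleph0 ≤ κ ∧
  (∃ (M : Type max u v) (_ : L.Structure M), M ⊨ T ∧ Infinite M) ∧
  ∀ (M : Type max u v) (_ : L.Structure M), M ⊨ T → Cardinal.mk M = κ → Aleph0Saturated L M

/-- A theory is `κ`-categorical if any two of its models of cardinality `κ` are
isomorphic. -/
def Categorical.{u, v} (L : FirstOrder.Language.{u, v}) (T : L.Theory)
    (κ : Cardinal.{max u v}) : Prop :=
  ∀ (M N : Type max u v) (_ : L.Structure M) (_ : L.Structure N),
    M ⊨ T → N ⊨ T → Cardinal.mk M = κ → Cardinal.mk N = κ → Nonempty (M ≃[L] N)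

/-- A theory is `ℵ₀`-categorical if any two of its countably infinite models are
isomorphic. -/
def Aleph0Categorical.{u, v} (L : FirstOrder.Language.{u, v}) (T : L.Theory) : Prop :=
  ∀ (M N : Type max u v) (_ : L.Structure M) (_ : L.Structure N),
    M ⊨ T → N ⊨ T → Countable M → Infinite M → Countable N → Infinite N →
      Nonempty (M ≃[L] N)

/-- A theory `T` has quantifier elimination if every `L`-formula is `T`-equivalent to a
quantifier-free formula with the same free variables. -/
def HasQE.{u, v} (L : FirstOrder.Language.{u, v}) (T : L.Theory) : Prop :=
  ∀ (n : ℕ) (φ : L.Formula (Fin n)), ∃ ψ : L.Formula (Fin n),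
    BoundedFormula.IsQF ψ ∧
    ∀ (M : Type max u v) (_ : L.Structure M), M ⊨ T →
      ∀ a : Fin n → M, Formula.Realize φ a ↔ Formula.Realize ψ a

/-- The theory of a potentialist system: the set of (finitary, non-modal) `L`-sentences
which hold in every world. -/
def ThOf.{u, v, w, x} {L : FirstOrder.Language.{u, v}} (S : PotSys.{u, v, w, x} L) :
    L.Theory :=
  {φ : L.Sentence | ∀ W : S.World, S.Dom W ⊨ φ}


/-- The set `p` of formulas is finitely realized over the parameters `a`. -/
def FinRealizedAt.{u, v, y} {L : FirstOrder.Language.{u, v}} {M : Type y} [L.Structure M]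
    {n : ℕ} (a : Fin n → M) (p : Set (L.Formula (Fin (n + 1)))) : Prop :=
  ∀ s : Finset (L.Formula (Fin (n + 1))), ↑s ⊆ p →
    ∃ c : M, ∀ φ ∈ s, Formula.Realize φ (Fin.snoc a c)

/-- The set of formulas true of the tuple `a`. -/
def tupleType.{u, v, y} (L : FirstOrder.Language.{u, v}) {M : Type y} [L.Structure M]
    {n : ℕ} (a : Fin n → M) : Set (L.Formula (Fin n)) :=
  {φ | φ.Realize a}

/-- The formula expressing that finitely many formulas are simultaneously satisfied by some
value of their last variable. -/
noncomputable def existsSnoc.{u, v} {L : FirstOrder.Language.{u, v}} {n : ℕ}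
    (s : Finset (L.Formula (Fin (n + 1)))) : L.Formula (Fin n) :=
  Formula.iExs Unit (Formula.iInf fun φ : s =>
    (φ : L.Formula (Fin (n + 1))).relabel (Fin.snoc Sum.inl (Sum.inr ()) : _ → Fin n ⊕ Unit))

theorem sumElim_comp_snoc.{y, z, w} {M : Type y} {N : Type z} {β : Type w} {n : ℕ} (g : M → N)
    (b : β → N) (a : Fin n → M) (i : β) :
    Sum.elim g b ∘ (Fin.snoc (Sum.inl ∘ a) (Sum.inr i) : Fin (n + 1) → M ⊕ β) =
      Fin.snoc (g ∘ a) (b i) := by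
  funext j
  refine Fin.lastCases ?_ (fun j => ?_) j <;> simp

theorem realize_existsSnoc.{u, v, y} {L : FirstOrder.Language.{u, v}} {M : Type y}
    [L.Structure M] {n : ℕ} (s : Finset (L.Formula (Fin (n + 1)))) (a : Fin n → M) :
    (existsSnoc s).Realize a ↔ ∃ c : M, ∀ φ ∈ s, Formula.Realize φ (Fin.snoc a c) := by
  have h : ∀ i : Unit → M, Sum.elim a i ∘
      (Fin.snoc Sum.inl (Sum.inr ()) : Fin (n + 1) → Fin n ⊕ Unit) = Fin.snoc a (i ()) :=
    fun i => sumElim_comp_snoc a i id ()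
  simp only [existsSnoc, Formula.realize_iExs, Formula.realize_iInf, Formula.realize_relabel, h,
    Subtype.forall]
  exact ⟨fun ⟨i, hi⟩ => ⟨i (), hi⟩, fun ⟨c, hc⟩ => ⟨fun _ => c, hc⟩⟩

/-- Elementary embeddings preserve and reflect finite realizability. -/
theorem finRealizedAt_comp_iff.{u, v, y, z} {L : FirstOrder.Language.{u, v}} {M : Type y}
    {N : Type z} [L.Structure M] [L.Structure N] (f : M ↪ₑ[L] N) {n : ℕ} (a : Fin n → M)
    (p : Set (L.Formula (Fin (n + 1)))) :
    FinRealizedAt (f ∘ a) p ↔ FinRealizedAt a p := by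
  simp only [FinRealizedAt, ← realize_existsSnoc, f.map_formula]

/-- If the complete theory of `M` is categorical in the cardinality of `M`, then a set of formulas
with parameters in `M` that is finitely satisfied in `M` is satisfied in an elementary extension
of `M` which is again a copy of `M`. -/
theorem exists_elementaryEmbedding_self_realize.{u, v} {L : FirstOrder.Language.{u, v}}
    {M : Type max u v} [L.Structure M] (hL : L.card + Cardinal.aleph0 ≤ Cardinal.mk M)
    (hcat : Categorical L (L.completeTheory M) (Cardinal.mk M))
    {β : Type max u v} (hβ : Cardinal.mk β ≤ Cardinal.mk M) (Γ : Set (L.Formula (M ⊕ β)))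
    (hΓ : ∀ s : Finset (L.Formula (M ⊕ β)), ↑s ⊆ Γ →
      ∃ b : β → M, ∀ φ ∈ s, Formula.Realize φ (Sum.elim id b)) :
    ∃ (f : M ↪ₑ[L] M) (b : β → M), ∀ φ ∈ Γ, Formula.Realize φ (Sum.elim f b) := by
  classical
  have hinf : Cardinal.aleph0 ≤ Cardinal.mk M := le_trans le_add_self hL
  have hLM : L.card ≤ Cardinal.mk M := le_trans le_self_add hL
  have : Infinite M := Cardinal.infinite_iff.2 hinf
  let D : Set (L.Formula (M ⊕ β)) := {φ | ∃ ψ : L.Formula M, ψ.Realize id ∧ ψ.relabel Sum.inl = φ}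
  let Th : L[[M ⊕ β]].Theory := Formula.equivSentence '' (Γ ∪ D)
  have emb : ∀ {N : Type max u v} [L[[M ⊕ β]].Structure N] [L.Structure N]
      [(L.lhomWithConstants (M ⊕ β)).IsExpansionOn N] (_ : N ⊨ Th),
      ∃ (f : M ↪ₑ[L] N) (b : β → N), ∀ φ ∈ Γ, Formula.Realize φ (Sum.elim f b) := by
    intro N _ _ _ hN
    let v : M ⊕ β → N := fun x => (L.con x : N)
    have hv : ∀ φ ∈ Γ ∪ D, φ.Realize v := fun φ hφ =>
      (Formula.realize_equivSentence _ _).1 (hN.realize_of_mem _ ⟨φ, hφ, rfl⟩)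
    have hd : ∀ ψ : L.Formula M, ψ.Realize id → ψ.Realize (v ∘ Sum.inl) := fun ψ hψ => by
      simpa [Formula.realize_relabel] using hv _ (Or.inr ⟨ψ, hψ, rfl⟩)
    have hd' : ∀ ψ : L.Formula M, ψ.Realize (v ∘ Sum.inl) ↔ ψ.Realize id := fun ψ =>
      ⟨fun h => by_contra fun h' => (hd ψ.not (by simpa using h')) h, hd ψ⟩
    refine ⟨⟨v ∘ Sum.inl, fun n φ x => ?_⟩, v ∘ Sum.inr, fun φ hφ => ?_⟩
    · simpa [Formula.realize_relabel, Function.comp_assoc] using hd' (φ.relabel x)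
    · convert hv φ (Or.inl hφ) using 1
      exact Sum.elim_comp_inl_inr v
  have hsat : Th.IsSatisfiable := by
    rw [Theory.isSatisfiable_iff_isFinitelySatisfiable]
    intro T₀ hT₀
    obtain ⟨s, hs, rfl⟩ := Finset.subset_set_image_iff.1 hT₀
    obtain ⟨b, hb⟩ := hΓ (s.filter (· ∈ Γ)) (fun φ hφ => (Finset.mem_filter.1 hφ).2)
    let : (constantsOn (M ⊕ β)).Structure M := constantsOn.structure (Sum.elim id b)
    have : M ⊨ ((s.image Formula.equivSentence : Finset L[[M ⊕ β]].Sentence) :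
        L[[M ⊕ β]].Theory) := by
      refine ⟨fun χ hχ => ?_⟩
      obtain ⟨φ, hφ, rfl⟩ := Finset.mem_image.1 hχ
      refine (Formula.realize_equivSentence _ _).2 ?_
      change φ.Realize (Sum.elim id b)
      rcases hs hφ with h | ⟨ψ, hψ, rfl⟩
      · exact hb φ (Finset.mem_filter.2 ⟨hφ, h⟩)
      · simpa [Formula.realize_relabel] using hψ
    exact Theory.Model.isSatisfiable M
  obtain ⟨N₀⟩ := hsat
  have hN₀ : Infinite N₀ := by
    let := (L.lhomWithConstants (M ⊕ β)).reduct N₀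
    have := LHom.isExpansionOn_reduct (L.lhomWithConstants (M ⊕ β)) N₀
    obtain ⟨f, -⟩ := emb (N := N₀) N₀.is_model
    exact Infinite.of_injective f f.injective
  obtain ⟨N, hN⟩ := Theory.exists_model_card_eq.{max u v, v, max u v} ⟨N₀, hN₀⟩ (Cardinal.mk M)
    hinf (by
      simp only [card_withConstants, Cardinal.mk_sum, Cardinal.lift_id]
      exact Cardinal.add_le_of_le hinf hLM (Cardinal.add_le_of_le hinf le_rfl hβ))
  let := (L.lhomWithConstants (M ⊕ β)).reduct N
  have := LHom.isExpansionOn_reduct (L.lhomWithConstants (M ⊕ β)) N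
  obtain ⟨f, b, hfb⟩ := emb (N := N) N.is_model
  obtain ⟨e⟩ := hcat N M _ _
    (by rw [f.elementarilyEquivalent.completeTheory_eq]; exact inferInstance) inferInstance hN rfl
  refine ⟨e.toElementaryEmbedding.comp f, e ∘ b, fun φ hφ => ?_⟩
  have := (e.toElementaryEmbedding.map_formula φ _).2 (hfb φ hφ)
  rw [Sum.comp_elim] at this
  exact this

/-- If the complete theory of `M` is categorical in the cardinality of `M`, then every finitely
realized type over a finite tuple is contained in the type over this tuple given by the complete
type of some tuple of `M`. -/
theorem exists_subset_tupleType.{u, v} {L : FirstOrder.Language.{u, v}}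
    {M : Type max u v} [L.Structure M] (hL : L.card + Cardinal.aleph0 ≤ Cardinal.mk M)
    (hcat : Categorical L (L.completeTheory M) (Cardinal.mk M)) {n : ℕ} {a : Fin n → M}
    {p : Set (L.Formula (Fin (n + 1)))} (hp : FinRealizedAt a p) :
    ∃ m : Fin (n + 1) → M, p ⊆ tupleType L m ∧ FinRealizedAt a (tupleType L m) := by
  classical
  have hinf : Cardinal.aleph0 ≤ Cardinal.mk M := le_trans le_add_self hL
  obtain ⟨f, b, h⟩ := exists_elementaryEmbedding_self_realize hL hcat (β := PUnit)
    (by simpa using Cardinal.one_le_aleph0.trans hinf)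
    ((fun φ : L.Formula (Fin (n + 1)) =>
      φ.relabel (Fin.snoc (Sum.inl ∘ a) (Sum.inr PUnit.unit) : _ → M ⊕ PUnit)) '' p) (by
      intro s hs
      obtain ⟨t, ht, rfl⟩ := Finset.subset_set_image_iff.1 hs
      obtain ⟨c, hc⟩ := hp t ht
      refine ⟨fun _ => c, Finset.forall_mem_image.2 fun φ hφ => ?_⟩
      rw [Formula.realize_relabel, sumElim_comp_snoc]
      exact hc φ hφ)
  refine ⟨Fin.snoc (f ∘ a) (b PUnit.unit), fun φ hφ => ?_, ?_⟩
  · have := h _ ⟨φ, hφ, rfl⟩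
    rwa [Formula.realize_relabel, sumElim_comp_snoc] at this
  · rw [← finRealizedAt_comp_iff f]
    exact fun s hs => ⟨b PUnit.unit, fun φ hφ => hs hφ⟩

/-- If the complete theory of `M` is categorical in the cardinality of `M`, then `M` has an
elementary self-embedding such that all types over finite tuples of its range are realized. -/
theorem exists_elementaryEmbedding_self_realizing_types.{u, v} {L : FirstOrder.Language.{u, v}}
    {M : Type max u v} [L.Structure M] (hL : L.card + Cardinal.aleph0 ≤ Cardinal.mk M)
    (hcat : Categorical L (L.completeTheory M) (Cardinal.mk M)) :
    ∃ f : M ↪ₑ[L] M, ∀ (n : ℕ) (a : Fin n → M) (p : Set (L.Formula (Fin (n + 1)))),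
      FinRealizedAt a p → ∃ c : M, ∀ φ ∈ p, Formula.Realize φ (Fin.snoc (f ∘ a) c) := by
  classical
  have hinf : Cardinal.aleph0 ≤ Cardinal.mk M := le_trans le_add_self hL
  have : Infinite M := Cardinal.infinite_iff.2 hinf
  let β : Type max u v := {i : Σ n, (Fin n → M) × (Fin (n + 1) → M) //
    FinRealizedAt i.2.1 (tupleType L i.2.2)}
  have hβ : Cardinal.mk β ≤ Cardinal.mk M := by
    have htuple : Cardinal.mk (Σ n, Fin n → M) = Cardinal.mk M := by
      rw [← Cardinal.mk_congr List.equivSigmaTuple, Cardinal.mk_list_eq_mk]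
    calc Cardinal.mk β ≤ Cardinal.mk ((Σ n, Fin n → M) × (Σ n, Fin n → M)) := by
          refine Cardinal.mk_le_of_injective
            (f := fun i => (⟨i.1.1, i.1.2.1⟩, ⟨i.1.1 + 1, i.1.2.2⟩)) ?_
          rintro ⟨⟨n, a, m⟩, _⟩ ⟨⟨n', a', m'⟩, _⟩ h
          simp only [Prod.mk.injEq, Sigma.mk.injEq] at h
          obtain ⟨⟨rfl, ha⟩, -, hm⟩ := h
          simp_all
      _ = Cardinal.mk M := by
          rw [← Cardinal.mul_def, htuple, Cardinal.mul_eq_self hinf]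
  let var : ∀ i : β, Fin (i.1.1 + 1) → M ⊕ β := fun i => Fin.snoc (Sum.inl ∘ i.1.2.1) (Sum.inr i)
  obtain ⟨f, b, h⟩ := exists_elementaryEmbedding_self_realize hL hcat hβ
    (⋃ i : β, (fun φ => φ.relabel (var i)) '' tupleType L i.1.2.2) (by
      intro s hs
      have hfin : ∀ i : β, ∃ c : M, ∀ φ ∈ tupleType L i.1.2.2, φ.relabel (var i) ∈ s →
          Formula.Realize φ (Fin.snoc i.1.2.1 c) := by
        intro i
        obtain ⟨t, ht, hts⟩ := Finset.subset_set_image_iff.1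
          (show ↑(s.filter (· ∈ (fun φ => φ.relabel (var i)) '' tupleType L i.1.2.2)) ⊆
            (fun φ => φ.relabel (var i)) '' tupleType L i.1.2.2 from
            fun φ hφ => (Finset.mem_filter.1 hφ).2)
        obtain ⟨c, hc⟩ := i.2 t ht
        refine ⟨c, fun φ hφ hφs => ?_⟩
        have hmem := Finset.mem_filter.2 ⟨hφs, Set.mem_image_of_mem _ hφ⟩
        rw [← hts] at hmem
        obtain ⟨ψ, hψ, hψφ⟩ := Finset.mem_image.1 hmem
        have hval : Sum.elim id (fun _ => c) ∘ var i = Fin.snoc i.1.2.1 c :=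
          sumElim_comp_snoc id (fun _ => c) i.1.2.1 i
        rw [← hval, ← Formula.realize_relabel, ← hψφ, Formula.realize_relabel, hval]
        exact hc ψ hψ
      choose c hc using hfin
      refine ⟨c, fun φ hφ => ?_⟩
      obtain ⟨i, ψ, hψ, rfl⟩ := Set.mem_iUnion.1 (hs hφ)
      have := hc i ψ hψ hφ
      simp only [Formula.realize_relabel, var]
      rwa [sumElim_comp_snoc])
  refine ⟨f, fun n a p hp => ?_⟩
  obtain ⟨m, hpm, hm⟩ := exists_subset_tupleType hL hcat hp
  let i : β := ⟨⟨n, a, m⟩, hm⟩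
  refine ⟨b i, fun φ hφ => ?_⟩
  have := h (φ.relabel (var i)) (Set.mem_iUnion.2 ⟨i, φ, hpm hφ, rfl⟩)
  simp only [Formula.realize_relabel, var] at this
  rwa [sumElim_comp_snoc] at this

theorem directLimit_of_comp_map.{u, v, w, y, z} {L : FirstOrder.Language.{u, v}} {ι : Type w}
    [Preorder ι] [IsDirectedOrder ι] [Nonempty ι] {G : ι → Type y} [∀ i, L.Structure (G i)]
    (f : ∀ i j, i ≤ j → G i ↪[L] G j) [DirectedSystem G fun i j h => f i j h]
    {i j : ι} (hij : i ≤ j) {γ : Type z} (x : γ → G i) :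
    DirectLimit.of L ι G f j ∘ (f i j hij ∘ x) = DirectLimit.of L ι G f i ∘ x :=
  funext fun _ => DirectLimit.of_f

/-- In a directed system of elementary embeddings, the canonical maps to the direct limit are
elementary. -/
theorem realize_directLimit_of.{u, v, w, y} {L : FirstOrder.Language.{u, v}} {ι : Type w}
    [Preorder ι] [IsDirectedOrder ι] [Nonempty ι] {G : ι → Type y} [∀ i, L.Structure (G i)]
    (f : ∀ i j, i ≤ j → G i ↪[L] G j) [DirectedSystem G fun i j h => f i j h]
    (hf : ∀ i j h, ∃ e : G i ↪ₑ[L] G j, ⇑e = f i j h) {α : Type*} {n : ℕ}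
    (φ : L.BoundedFormula α n) (i : ι) (v : α → G i) (xs : Fin n → G i) :
    φ.Realize (DirectLimit.of L ι G f i ∘ v) (DirectLimit.of L ι G f i ∘ xs) ↔
      φ.Realize v xs := by
  induction φ generalizing i with
  | falsum => rfl
  | equal t₁ t₂ =>
    exact (BoundedFormula.IsAtomic.equal t₁ t₂).isQF.realize_embedding _
  | rel R ts => exact (BoundedFormula.IsAtomic.rel R ts).isQF.realize_embedding _
  | imp φ ψ ihφ ihψ => simp [ihφ, ihψ]
  | all φ ih =>
    simp only [BoundedFormula.realize_all]
    refine ⟨fun h x => ?_, fun h z => ?_⟩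
    · refine (ih i v _).1 ?_
      rw [Fin.comp_snoc]
      exact h _
    · obtain ⟨j, x, rfl⟩ := DirectLimit.exists_of z
      obtain ⟨k, hik, hjk⟩ := exists_ge_ge i j
      obtain ⟨e, he⟩ := hf i k hik
      rw [← directLimit_of_comp_map f hik v, ← directLimit_of_comp_map f hik xs,
        ← DirectLimit.of_f (hij := hjk), ← Fin.comp_snoc]
      refine (ih k _ _).2 ?_
      rw [← he]
      exact ((e.map_boundedFormula φ.all v xs).2 h) _

/-- If the complete theory of `M` is categorical in the cardinality of `M`, then it has an
`ℵ₀`-saturated model of that cardinality: the direct limit of the iterates of an elementary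
self-embedding of `M` such that all types over finite tuples of its range are realized. -/
theorem exists_aleph0Saturated_of_categorical.{u, v} {L : FirstOrder.Language.{u, v}}
    {M : Type max u v} [L.Structure M] (hL : L.card + Cardinal.aleph0 ≤ Cardinal.mk M)
    (hcat : Categorical L (L.completeTheory M) (Cardinal.mk M)) :
    ∃ (N : Type max u v) (_ : L.Structure N), Cardinal.mk N = Cardinal.mk M ∧
      N ⊨ L.completeTheory M ∧ Aleph0Saturated L N := by
  have hinf : Cardinal.aleph0 ≤ Cardinal.mk M := le_trans le_add_self hL
  have : Infinite M := Cardinal.infinite_iff.2 hinf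
  obtain ⟨f, hf⟩ := exists_elementaryEmbedding_self_realizing_types hL hcat
  let F : ∀ i j : ℕ, i ≤ j → M ↪[L] M :=
    DirectedSystem.natLERec (G' := fun _ => M) fun _ => f.toEmbedding
  have : DirectedSystem (fun _ : ℕ => M) fun i j h => F i j h :=
    DirectedSystem.natLERec.directedSystem (G' := fun _ => M) fun _ => f.toEmbedding
  have hF : ∀ i j h, ∃ e : M ↪ₑ[L] M, ⇑e = F i j h := by
    intro i j h
    induction j, h using Nat.le_induction with
    | base => exact ⟨ElementaryEmbedding.refl L M, by ext; simp [F, Nat.leRecOn_self]⟩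
    | succ j h ih =>
      obtain ⟨e, he⟩ := ih
      refine ⟨f.comp e, ?_⟩
      ext x
      simp [F, Nat.leRecOn_succ h, he]
  have hFsucc : ∀ (k : ℕ) (x : M), F k (k + 1) k.le_succ x = f x := by
    intro k x
    simp [F, Nat.leRecOn_succ']
  let N := Language.DirectLimit (fun _ : ℕ => M) F
  let E : ℕ → M ↪ₑ[L] N := fun k => ⟨DirectLimit.of L ℕ (fun _ => M) F k, fun n φ x => by
    have := realize_directLimit_of F hF φ k x default
    rwa [Unique.eq_default (_ ∘ default)] at this⟩
  have hE : ∀ (k : ℕ) (x : M), E (k + 1) (f x) = E k x := fun k x => by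
    rw [← hFsucc k x]
    exact DirectLimit.of_f
  refine ⟨N, inferInstance, le_antisymm ?_ ?_, ?_, ?_⟩
  · have hsurj : Function.Surjective fun x : ℕ × M => E x.1 x.2 := fun z =>
      let ⟨i, x, h⟩ := DirectLimit.exists_of z
      ⟨(i, x), h⟩
    refine (Cardinal.mk_le_of_surjective hsurj).trans ?_
    simp [Cardinal.aleph0_mul_eq hinf]
  · exact Cardinal.mk_le_of_injective (E 0).injective
  · rw [(E 0).elementarilyEquivalent.completeTheory_eq]
    infer_instance
  · intro n a p hp
    obtain ⟨k, a, rfl⟩ := DirectLimit.exists_quotient_mk'_sigma_mk'_eq (fun _ : ℕ => M) F a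
    have hp' : FinRealizedAt a p := (finRealizedAt_comp_iff (E k) a p).1 hp
    obtain ⟨c, hc⟩ := hf n a p hp'
    refine ⟨E (k + 1) c, fun φ hφ => ?_⟩
    have h := ((E (k + 1)).map_formula φ _).2 (hc φ hφ)
    rw [Fin.comp_snoc, ← Function.comp_assoc, show E (k + 1) ∘ f = E k from funext (hE k)] at h
    exact h

/-- `ℵ₀`-saturation is invariant under isomorphism. -/
theorem Aleph0Saturated.of_equiv.{u, v, y, z} {L : FirstOrder.Language.{u, v}} {M : Type y}
    {N : Type z} [L.Structure M] [L.Structure N] (h : Aleph0Saturated L M) (e : M ≃[L] N) :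
    Aleph0Saturated L N := by
  intro n a p hp
  have ha : e ∘ e.symm ∘ a = a := by ext; simp
  have hp' : FinRealizedAt (e.symm ∘ a) p :=
    (finRealizedAt_comp_iff e.symm.toElementaryEmbedding a p).2 hp
  obtain ⟨c, hc⟩ := h n _ p hp'
  refine ⟨e c, fun φ hφ => ?_⟩
  have := (e.toElementaryEmbedding.map_formula φ _).2 (hc φ hφ)
  rw [Fin.comp_snoc] at this
  rwa [← ha]

/-- let `T` be a first-order `L`-theory with an infinite model, and let
`κ ≥ |L| + ℵ₀`.  If every completion of `T` is `κ`-categorical, then `T` is `κ`-rich. -/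
theorem rich_of_completions_categorical.{u, v}
    (L : FirstOrder.Language.{u, v}) (T : L.Theory) (κ : Cardinal.{max u v})
    (hκ : Language.card L + Cardinal.aleph0 ≤ κ)
    (hinf : ∃ (M : Type max u v) (_ : L.Structure M), M ⊨ T ∧ Infinite M)
    (hcat : ∀ T' : L.Theory, T ⊆ T' → T'.IsMaximal → Categorical L T' κ) :
    Rich L T κ := by
  refine ⟨hκ, hinf, fun M _ hM hMκ => ?_⟩
  subst hMκ
  have hcard : Cardinal.aleph0 ≤ Cardinal.mk M := le_trans le_add_self hκ
  have : Infinite M := Cardinal.infinite_iff.2 hcard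
  have hc := hcat (L.completeTheory M) (fun φ hφ => hM.realize_of_mem φ hφ)
    (completeTheory.isMaximal L M)
  obtain ⟨N, _, hNM, hN, hsat⟩ := exists_aleph0Saturated_of_categorical hκ hc
  obtain ⟨e⟩ := hc N M _ _ hN inferInstance hNM rfl
  exact hsat.of_equiv e

end Potentialist
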